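/- arXiv:1405.3096 — 2 statements merged into one kernel-verified Lean document; each statement's English description precedes it below -/
import Mathlib

section
/- Let A be a ring with an increasing exhaustive filtration (F_kA)_{k≥0} by additive subgroups such that 1 ∈ F_0A and F_iA · F_jA ⊆ F_{i+j}A. Let (M',F), (M,F), (M'',F) be right A-modules with increasing exhaustive filtrations compatible with the filtration of A, and let u : M' → M and v : M → M'' be filtration-preserving A-linear maps with v ∘ u = 0. For p ∈ ℤ set H_p = (F_pM ∩ ker v) / u(F_pM'), and let z_p : H_p → H_{p+1} be the map induced by the inclusion F_pM ⊆ F_{p+1}M. Then z_p is injective for every p ∈ ℤ if and only if u is strictly compatible with the filtrations, i.e. u(F_pM') = u(M') ∩ F_pM for every p. -/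
open MulOpposite

/-- The quotient `S / (U ∩ S)` of an additive subgroup `S` by (the trace of) an additive
subgroup `U`. -/
abbrev SubQuot {M : Type*} [AddCommGroup M] (S U : AddSubgroup M) :=
  ↥S ⧸ (U.addSubgroupOf S)

/-- The subgroup `F_p M ∩ ker v` of `M`. -/
abbrev strictS {A : Type*} [Ring A] {M M'' : Type*} [AddCommGroup M] [Module Aᵐᵒᵖ M]
    [AddCommGroup M''] [Module Aᵐᵒᵖ M''] (Fm : ℤ → AddSubgroup M)
    (v : M →ₗ[Aᵐᵒᵖ] M'') (p : ℤ) : AddSubgroup M :=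
  Fm p ⊓ (LinearMap.ker v).toAddSubgroup

/-- The subgroup `u (F_p M')` of `M`. -/
abbrev strictU {A : Type*} [Ring A] {M' M : Type*} [AddCommGroup M'] [Module Aᵐᵒᵖ M']
    [AddCommGroup M] [Module Aᵐᵒᵖ M] (F' : ℤ → AddSubgroup M')
    (u : M' →ₗ[Aᵐᵒᵖ] M) (p : ℤ) : AddSubgroup M :=
  AddSubgroup.map u.toAddMonoidHom (F' p)

/-- **Strictness of a complex of filtered modules at the middle term.**
Let `(A, F)` be a filtered ring, let `(M', F')`, `(M, Fm)`, `(M'', F'')` be right `A`-modules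
with increasing exhaustive filtrations compatible with the filtration of `A`, and let
`u : M' → M`, `v : M → M''` be filtration-preserving `A`-linear maps with `v ∘ u = 0`.
For `p : ℤ` set `H p = (F_p M ∩ ker v) / u(F_p M')` and let `z p : H p → H (p+1)` be the map
induced by the inclusion `F_p M ⊆ F_{p+1} M`.  Then `z p` is injective for every `p` if and
only if `u` is strictly compatible with the filtrations, i.e. `u(F_p M') = u(M') ∩ F_p M`
for every `p`. -/
theorem stmt_7 (A : Type*) [Ring A] (F : ℕ → AddSubgroup A)
    (hFmono : Monotone F) (hFexh : (⨆ k : ℕ, F k) = ⊤)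
    (hone : (1 : A) ∈ F 0)
    (hmul : ∀ i j : ℕ, ∀ a b : A, a ∈ F i → b ∈ F j → a * b ∈ F (i + j))
    (M' M M'' : Type*)
    [AddCommGroup M'] [Module Aᵐᵒᵖ M'] [AddCommGroup M] [Module Aᵐᵒᵖ M]
    [AddCommGroup M''] [Module Aᵐᵒᵖ M'']
    (F' : ℤ → AddSubgroup M') (Fm : ℤ → AddSubgroup M) (F'' : ℤ → AddSubgroup M'')
    (hF'mono : Monotone F') (hF'exh : (⨆ p : ℤ, F' p) = ⊤)
    (hF'compat : ∀ (p : ℤ) (k : ℕ) (m : M') (a : A),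
      m ∈ F' p → a ∈ F k → op a • m ∈ F' (p + k))
    (hFmmono : Monotone Fm) (hFmexh : (⨆ p : ℤ, Fm p) = ⊤)
    (hFmcompat : ∀ (p : ℤ) (k : ℕ) (m : M) (a : A),
      m ∈ Fm p → a ∈ F k → op a • m ∈ Fm (p + k))
    (hF''mono : Monotone F'') (hF''exh : (⨆ p : ℤ, F'' p) = ⊤)
    (hF''compat : ∀ (p : ℤ) (k : ℕ) (m : M'') (a : A),
      m ∈ F'' p → a ∈ F k → op a • m ∈ F'' (p + k))
    (u : M' →ₗ[Aᵐᵒᵖ] M) (v : M →ₗ[Aᵐᵒᵖ] M'')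
    (hu : ∀ p : ℤ, ∀ x ∈ F' p, u x ∈ Fm p)
    (hv : ∀ p : ℤ, ∀ x ∈ Fm p, v x ∈ F'' p)
    (hvu : ∀ x : M', v (u x) = 0)
    (z : ∀ p : ℤ, SubQuot (strictS Fm v p) (strictU F' u p) →+
      SubQuot (strictS Fm v (p + 1)) (strictU F' u (p + 1)))
    (hz : ∀ (p : ℤ) (m : M) (hm : m ∈ strictS Fm v p) (hm' : m ∈ strictS Fm v (p + 1)),
      z p (QuotientAddGroup.mk ⟨m, hm⟩) = QuotientAddGroup.mk ⟨m, hm'⟩) :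
    (∀ p : ℤ, Function.Injective (z p)) ↔
      (∀ p : ℤ, u '' (F' p : Set M') = Set.range u ∩ (Fm p : Set M)) := by
  have key : ∀ p : ℤ, Function.Injective (z p) ↔
      ∀ m : M, m ∈ strictS Fm v p → m ∈ strictU F' u (p + 1) → m ∈ strictU F' u p := by
    intro p
    have hle : ∀ m : M, m ∈ strictS Fm v p → m ∈ strictS Fm v (p + 1) := fun m hm =>
      ⟨hFmmono (by omega) hm.1, hm.2⟩
    rw [injective_iff_map_eq_zero]
    constructor
    · intro h m hm hm1
      have h1 := h (QuotientAddGroup.mk ⟨m, hm⟩) (by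
        rw [hz p m hm (hle m hm), QuotientAddGroup.eq_zero_iff]
        exact AddSubgroup.mem_addSubgroupOf.2 hm1)
      rw [QuotientAddGroup.eq_zero_iff] at h1
      exact AddSubgroup.mem_addSubgroupOf.1 h1
    · intro h a
      induction a using QuotientAddGroup.induction_on with
      | H x =>
        obtain ⟨m, hm⟩ := x
        intro h1
        rw [hz p m hm (hle m hm), QuotientAddGroup.eq_zero_iff] at h1
        rw [QuotientAddGroup.eq_zero_iff]
        exact AddSubgroup.mem_addSubgroupOf.2 (h m hm (AddSubgroup.mem_addSubgroupOf.1 h1))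
  simp only [key]
  constructor
  · intro h p
    have step : ∀ n : ℕ, ∀ m : M, m ∈ strictS Fm v p → m ∈ strictU F' u (p + n) →
        m ∈ strictU F' u p := by
      intro n
      induction n with
      | zero => intro m _ h2; simpa using h2
      | succ n ih =>
        intro m h1 h2
        refine ih m h1 (h (p + n) m ⟨hFmmono (by omega) h1.1, h1.2⟩ ?_)
        have e : p + (n : ℤ) + 1 = p + ((n + 1 : ℕ) : ℤ) := by push_cast; ring
        rw [e]; exact h2
    apply Set.Subset.antisymm
    · rintro _ ⟨x, hx, rfl⟩
      exact ⟨⟨x, rfl⟩, hu p x hx⟩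
    · rintro _ ⟨⟨x, rfl⟩, hx⟩
      have hxt : x ∈ ⨆ p : ℤ, F' p := by rw [hF'exh]; trivial
      obtain ⟨q, hq⟩ := (AddSubgroup.mem_iSup_of_directed hF'mono.directed_le).1 hxt
      exact step (q - p).toNat (u x) ⟨hx, hvu x⟩ ⟨x, hF'mono (by omega) hq, rfl⟩
  · rintro h p m hm ⟨x, hx, rfl⟩
    have hmem : u x ∈ u '' (F' p : Set M') := by
      rw [h p]; exact ⟨⟨x, rfl⟩, hm.1⟩
    exact hmem
end

section
/- Let 𝒜 be an abelian category, let K be an object of the bounded derived category D^b(𝒜), and let η : K → K[2] be a morphism. For i ≥ 1 let η^i : K → K[2i] denote the i-fold composite of the shifts of η. If for every i ≥ 1 the induced map H^{−i}(K) → H^{i}(K) (obtained by applying H^{−i} to η^i and using H^{−i}(K[2i]) = H^{i}(K)) is an isomorphism, then K is isomorphic in D^b(𝒜) to the direct sum ⊕_{n∈ℤ} H^n(K)[−n]. -/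
open CategoryTheory CategoryTheory.Limits

universe w v u

/-- The cochain complex with prescribed objects and zero differentials.  For a bounded
complex `K`, the complex with objects `H^n(K)` and zero differentials represents the direct
sum `⊕_n H^n(K)[−n]` in the derived category. -/
def zeroDiffComplex {C : Type u} [Category.{v} C] [HasZeroMorphisms C] (X : ℤ → C) :
    CochainComplex C ℤ where
  X := X
  d _ _ := 0
  shape _ _ _ := rfl
  d_comp_d' := by intros; simp

/-- The `i`-fold iterate `η^i : X ⟶ X⟦2i⟧` of a morphism `η : X ⟶ X⟦2⟧` in a category with
a shift by `ℤ`. -/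
noncomputable def etaPow {D : Type*} [Category D] [HasShift D ℤ] (X : D)
    (η : X ⟶ X⟦(2 : ℤ)⟧) : (i : ℕ) → (X ⟶ X⟦(2 * (i : ℤ))⟧)
  | 0 => (shiftFunctorZero' D (2 * ((0 : ℕ) : ℤ)) (by simp)).inv.app X
  | (i + 1) => etaPow X η i ≫ (shiftFunctor D (2 * (i : ℤ))).map η ≫
      (shiftFunctorAdd' D (2 : ℤ) (2 * (i : ℤ)) (2 * (((i + 1 : ℕ)) : ℤ))
        (by push_cast; ring)).inv.app X

section Helpers

open Pretriangulated DerivedCategory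

variable {C : Type u} [Category.{v} C] [Abelian C] [HasDerivedCategory.{w} C]

open scoped ZeroObject

namespace DeligneAux

/-- Truncation triangles, with the induced isomorphisms on cohomology. -/
lemma exists_trunc (X : DerivedCategory C) (n : ℤ) :
    ∃ (A B : DerivedCategory C) (f : A ⟶ X) (g : X ⟶ B) (h : B ⟶ A⟦(1 : ℤ)⟧),
      Triangle.mk f g h ∈ distTriang (DerivedCategory C) ∧ A.IsLE n ∧ B.IsGE (n + 1) ∧
      (∀ j ≤ n, IsIso ((homologyFunctor C j).map f)) ∧
      (∀ j > n, IsIso ((homologyFunctor C j).map g)) := by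
  obtain ⟨A, B, hA, hB, f, g, h, mem⟩ :=
    (TStructure.t (C := C)).exists_triangle X n (n + 1) rfl
  have hA' : A.IsLE n := ⟨hA⟩
  have hB' : B.IsGE (n + 1) := ⟨hB⟩
  refine ⟨A, B, f, g, h, mem, hA', hB', fun j hj => ?_, fun j hj => ?_⟩
  · have h1 : Mono ((homologyFunctor C j).map f) :=
      (HomologySequence.mono_homologyMap_mor₁_iff _ mem (j - 1) j (by lia)).2
        ((B.isZero_of_isGE (n + 1) (j - 1) (by lia)).eq_of_src _ _)
    have h2 : Epi ((homologyFunctor C j).map f) :=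
      (HomologySequence.epi_homologyMap_mor₁_iff _ mem j).2
        ((B.isZero_of_isGE (n + 1) j (by lia)).eq_of_tgt _ _)
    exact isIso_of_mono_of_epi _
  · have h1 : Mono ((homologyFunctor C j).map g) :=
      (HomologySequence.mono_homologyMap_mor₂_iff _ mem j).2
        ((A.isZero_of_isLE n j (by lia)).eq_of_src _ _)
    have h2 : Epi ((homologyFunctor C j).map g) :=
      (HomologySequence.epi_homologyMap_mor₂_iff _ mem j (j + 1) (by lia)).2
        ((A.isZero_of_isLE n (j + 1) (by lia)).eq_of_tgt _ _)
    exact isIso_of_mono_of_epi _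

lemma isIso_shift_map {X Y : DerivedCategory C} (f : X ⟶ Y) (n a a' : ℤ) (h : n + a = a')
    (hf : IsIso ((homologyFunctor C a').map f)) :
    IsIso ((homologyFunctor C a).map (f⟦n⟧')) :=
  (NatIso.isIso_map_iff ((homologyFunctor C 0).shiftIso n a a' h) f).2 hf

lemma isZero_shift {X : DerivedCategory C} (n a a' : ℤ) (h : n + a = a')
    (hf : IsZero ((homologyFunctor C a').obj X)) :
    IsZero ((homologyFunctor C a).obj (X⟦n⟧)) :=
  hf.of_iso (((homologyFunctor C 0).shiftIso n a a' h).app X)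

lemma isIso_of_zeros {D : Type*} [Category D] {X Y : D} (f : X ⟶ Y) (hX : IsZero X)
    (hY : IsZero Y) : IsIso f :=
  ⟨hY.to_ X, hX.eq_of_src _ _, hY.eq_of_src _ _⟩

/-- A morphism between objects concentrated in one degree. -/
lemma isIso_of_concentrated {X Y : DerivedCategory C} (f : X ⟶ Y) (n : ℤ)
    [X.IsLE n] [X.IsGE n] [Y.IsLE n] [Y.IsGE n]
    (hf : IsIso ((homologyFunctor C n).map f)) : IsIso f := by
  rw [DerivedCategory.isIso_iff]
  intro m
  rcases lt_trichotomy m n with h | rfl | h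
  · exact isIso_of_zeros _ (X.isZero_of_isGE n m h) (Y.isZero_of_isGE n m h)
  · exact hf
  · exact isIso_of_zeros _ (X.isZero_of_isLE n m h) (Y.isZero_of_isLE n m h)

/-- The existence of a morphism `H^j(X)[-j] ⟶ X` inducing an isomorphism on `H^j`. -/
def HasSection (X : DerivedCategory C) (j : ℤ) : Prop :=
  ∃ (S : DerivedCategory C) (s : S ⟶ X), S.IsLE j ∧ S.IsGE j ∧
    IsIso ((homologyFunctor C j).map s)

/-- One step of the induction: splitting off the two extreme cohomology objects. -/
lemma peel (N : ℕ) (X : DerivedCategory C) (hge : X.IsGE (-((N : ℤ) + 1)))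
    (hle : X.IsLE ((N : ℤ) + 1))
    (e : X ⟶ X⟦(2 * ((N : ℤ) + 1))⟧)
    (he : IsIso ((homologyFunctor C (-((N : ℤ) + 1))).map e)) :
    HasSection X (-((N : ℤ) + 1)) ∧ HasSection X ((N : ℤ) + 1) ∧
    ∃ (K : DerivedCategory C) (ι : K ⟶ X) (p : X ⟶ K), K.IsGE (-(N : ℤ)) ∧ K.IsLE N ∧
      ∀ j : ℤ, -(N : ℤ) ≤ j → j ≤ N → IsIso ((homologyFunctor C j).map ι) ∧
        IsIso ((homologyFunctor C j).map p) := by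
  obtain ⟨A, B, f, g, h, hT, hA, hB, hf, hg⟩ := exists_trunc X (-((N : ℤ) + 1))
  obtain ⟨L, Y, i, b, h', hT', hL, hY, hi, hb⟩ := exists_trunc X N
  obtain ⟨K, Z, k, q, hd, hTK, hK, hZ, hk, -⟩ := exists_trunc B N
  have hA' : A.IsGE (-((N : ℤ) + 1)) := by
    rw [isGE_iff]
    intro j hj
    have := hf j (by lia)
    exact (X.isZero_of_isGE _ j hj).of_iso (asIso ((homologyFunctor C j).map f))
  have hY' : Y.IsLE ((N : ℤ) + 1) := by
    rw [isLE_iff]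
    intro j hj
    have := hb j (by lia)
    exact (X.isZero_of_isLE _ j hj).of_iso (asIso ((homologyFunctor C j).map b)).symm
  have hK' : K.IsGE (-(N : ℤ)) := by
    rw [isGE_iff]
    intro j hj
    have := hk j (by lia)
    exact (B.isZero_of_isGE (-((N : ℤ) + 1) + 1) j (by lia)).of_iso (asIso ((homologyFunctor C j).map k))
  have hφ : IsIso (f ≫ e ≫ b⟦(2 * ((N : ℤ) + 1))⟧') := by
    have h1 : TStructure.t.IsLE (Y⟦(2 * ((N : ℤ) + 1))⟧) (-((N : ℤ) + 1)) :=
      TStructure.t.isLE_shift Y ((N : ℤ) + 1) _ _ (by ring)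
    have h2 : TStructure.t.IsGE (Y⟦(2 * ((N : ℤ) + 1))⟧) (-((N : ℤ) + 1)) :=
      TStructure.t.isGE_shift Y ((N : ℤ) + 1) _ _ (by ring)
    refine isIso_of_concentrated _ (-((N : ℤ) + 1)) ?_
    have h3 := hf _ le_rfl
    have h4 := isIso_shift_map b (2 * ((N : ℤ) + 1)) (-((N : ℤ) + 1)) ((N : ℤ) + 1) (by ring)
      (hb _ (by lia))
    rw [Functor.map_comp, Functor.map_comp]
    infer_instance
  obtain ⟨r, hr⟩ : ∃ r : X ⟶ A, f ≫ r = 𝟙 A :=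
    ⟨e ≫ b⟦(2 * ((N : ℤ) + 1))⟧' ≫ inv (f ≫ e ≫ b⟦(2 * ((N : ℤ) + 1))⟧'), by
      have := IsIso.hom_inv_id (f ≫ e ≫ b⟦(2 * ((N : ℤ) + 1))⟧')
      simpa only [Category.assoc] using this⟩
  obtain ⟨σ, hσ⟩ : ∃ σ : Y ⟶ X, σ ≫ b = 𝟙 Y := by
    obtain ⟨σ, hσ⟩ := (shiftFunctor (DerivedCategory C) (2 * ((N : ℤ) + 1))).map_surjective
      (inv (f ≫ e ≫ b⟦(2 * ((N : ℤ) + 1))⟧') ≫ f ≫ e)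
    refine ⟨σ, (shiftFunctor (DerivedCategory C) (2 * ((N : ℤ) + 1))).map_injective ?_⟩
    have := IsIso.inv_hom_id (f ≫ e ≫ b⟦(2 * ((N : ℤ) + 1))⟧')
    rw [Functor.map_comp, hσ, CategoryTheory.Functor.map_id]
    simpa only [Category.assoc] using this
  obtain ⟨s, hs⟩ : ∃ s : B ⟶ X, 𝟙 X - r ≫ f = g ≫ s :=
    Triangle.yoneda_exact₂ _ hT (𝟙 X - r ≫ f) (by
      change f ≫ (𝟙 X - r ≫ f) = 0
      rw [Preadditive.comp_sub, reassoc_of% hr]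
      simp)
  obtain ⟨t, ht⟩ : ∃ t : X ⟶ L, 𝟙 X - b ≫ σ = t ≫ i :=
    Triangle.coyoneda_exact₂ _ hT' (𝟙 X - b ≫ σ) (by
      change (𝟙 X - b ≫ σ) ≫ b = 0
      rw [Preadditive.sub_comp, Category.assoc, hσ]
      simp)
  obtain ⟨l, hl⟩ : ∃ l : L ⟶ K, i ≫ g = l ≫ k :=
    Triangle.coyoneda_exact₂ _ hTK (i ≫ g)
      (TStructure.t.zero (Y := Z) _ (N : ℤ) ((N : ℤ) + 1))
  refine ⟨⟨A, f, hA, hA', hf _ le_rfl⟩, ⟨Y, σ, hY', hY, ?_⟩,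
    K, k ≫ s, t ≫ l, hK', hK, fun j hj hj' => ?_⟩
  · have := hb ((N : ℤ) + 1) (by lia)
    have h2 : IsIso ((homologyFunctor C ((N : ℤ) + 1)).map σ ≫
        (homologyFunctor C ((N : ℤ) + 1)).map b) := by
      rw [← Functor.map_comp, hσ]; infer_instance
    exact IsIso.of_isIso_comp_right _ ((homologyFunctor C ((N : ℤ) + 1)).map b)
  · have h1 := hg j (by lia)
    have h2 := hi j hj'
    have h3 := hk j hj'
    have h4 : IsIso ((homologyFunctor C j).map s) := by
      have : IsIso ((homologyFunctor C j).map g ≫ (homologyFunctor C j).map s) := by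
        have h0 : (homologyFunctor C j).map f = 0 :=
          (A.isZero_of_isLE (-((N : ℤ) + 1)) j (by lia)).eq_of_src _ _
        rw [← Functor.map_comp, ← hs, Functor.map_sub, Functor.map_comp, h0]
        simp only [comp_zero, sub_zero]
        infer_instance
      exact IsIso.of_isIso_comp_left ((homologyFunctor C j).map g) _
    have h5 : IsIso ((homologyFunctor C j).map t) := by
      have : IsIso ((homologyFunctor C j).map t ≫ (homologyFunctor C j).map i) := by
        have h0 : (homologyFunctor C j).map b = 0 :=
          (Y.isZero_of_isGE ((N : ℤ) + 1) j (by lia)).eq_of_tgt _ _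
        rw [← Functor.map_comp, ← ht, Functor.map_sub, Functor.map_comp, h0]
        simp only [zero_comp, sub_zero]
        infer_instance
      exact IsIso.of_isIso_comp_right _ ((homologyFunctor C j).map i)
    have h6 : IsIso ((homologyFunctor C j).map l) := by
      have : IsIso ((homologyFunctor C j).map l ≫ (homologyFunctor C j).map k) := by
        rw [← Functor.map_comp, ← hl, Functor.map_comp]
        infer_instance
      exact IsIso.of_isIso_comp_right _ ((homologyFunctor C j).map k)
    constructor
    · rw [Functor.map_comp]; infer_instance
    · rw [Functor.map_comp]; infer_instance

lemma hasSection_of_isZero (X : DerivedCategory C) (j : ℤ)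
    (h : IsZero ((homologyFunctor C j).obj X)) : HasSection X j := by
  have hz : ∀ m, IsZero ((homologyFunctor C m).obj (0 : DerivedCategory C)) := fun m =>
    (homologyFunctor C m).map_isZero (isZero_zero _)
  exact ⟨0, 0, (isLE_iff _ _).2 fun m _ => hz m, (isGE_iff _ _).2 fun m _ => hz m,
    isIso_of_zeros _ (hz j) h⟩

lemma hasSection_all (N : ℕ) : ∀ (X : DerivedCategory C) (_ : X.IsGE (-(N : ℤ)))
    (_ : X.IsLE (N : ℤ))
    (_ : ∀ i : ℕ, 1 ≤ i → ∃ e : X ⟶ X⟦(2 * (i : ℤ))⟧,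
      IsIso ((homologyFunctor C (-(i : ℤ))).map e)) (j : ℤ), HasSection X j := by
  induction N with
  | zero =>
    intro X hge hle _ j
    simp only [Nat.cast_zero, neg_zero] at hge hle
    rcases lt_trichotomy j 0 with h | rfl | h
    · exact hasSection_of_isZero _ _ (X.isZero_of_isGE 0 j h)
    · exact ⟨X, 𝟙 X, hle, hge, inferInstance⟩
    · exact hasSection_of_isZero _ _ (X.isZero_of_isLE 0 j h)
  | succ N ih =>
    intro X hge hle he j
    push_cast at hge hle
    have hc : ((N + 1 : ℕ) : ℤ) = (N : ℤ) + 1 := by push_cast; rfl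
    have he1 := he (N + 1) (by lia)
    rw [hc] at he1
    obtain ⟨e, he'⟩ := he1
    obtain ⟨h1, h2, K, ι, p, hK, hK', hιp⟩ := peel N X hge hle e he'
    have key := ih K hK hK' (fun i hi => by
      by_cases hiN : i ≤ N
      · obtain ⟨e, he⟩ := he i hi
        refine ⟨ι ≫ e ≫ p⟦(2 * (i : ℤ))⟧', ?_⟩
        have h3 := (hιp (-(i : ℤ)) (by lia) (by lia)).1
        have h4 := isIso_shift_map p (2 * (i : ℤ)) (-(i : ℤ)) (i : ℤ) (by ring)
          (hιp (i : ℤ) (by lia) (by lia)).2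
        rw [Functor.map_comp, Functor.map_comp]
        infer_instance
      · exact ⟨0, isIso_of_zeros _ (K.isZero_of_isGE (-(N : ℤ)) _ (by lia))
          (isZero_shift (2 * (i : ℤ)) (-(i : ℤ)) (i : ℤ) (by ring)
            (K.isZero_of_isLE (N : ℤ) _ (by lia)))⟩)
    by_cases hj1 : j < -((N : ℤ) + 1)
    · exact hasSection_of_isZero _ _ (X.isZero_of_isGE _ j hj1)
    by_cases hj2 : (N : ℤ) + 1 < j
    · exact hasSection_of_isZero _ _ (X.isZero_of_isLE _ j hj2)
    by_cases hj3 : j = -((N : ℤ) + 1)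
    · rw [hj3]; exact h1
    by_cases hj4 : j = (N : ℤ) + 1
    · rw [hj4]; exact h2
    obtain ⟨S, s, hS, hS', hs⟩ := key j
    have := (hιp j (by lia) (by lia)).1
    refine ⟨S, s ≫ ι, hS, hS', ?_⟩
    rw [Functor.map_comp]
    infer_instance

/-- From a section in degree `j`, a morphism from the single complex on `H^j(K)`. -/
lemma exists_single (K : CochainComplex C ℤ) (j : ℤ) (h : HasSection (Q.obj K) j) :
    ∃ s : (singleFunctor C j).obj (K.homology j) ⟶ Q.obj K,
      IsIso ((homologyFunctor C j).map s) := by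
  obtain ⟨S, s, hS, hS', hs⟩ := h
  obtain ⟨A, ⟨e⟩⟩ := exists_iso_singleFunctor_obj_of_isGE_of_isLE S j
  have e' : K.homology j ≅ A :=
    (homologyFunctorFactors C j).symm.app K ≪≫ (asIso ((homologyFunctor C j).map s)).symm ≪≫
      (homologyFunctor C j).mapIso e ≪≫ (singleFunctorCompHomologyFunctorIso C j).app A
  refine ⟨(singleFunctor C j).map e'.hom ≫ e.inv ≫ s, ?_⟩
  rw [Functor.map_comp, Functor.map_comp]
  infer_instance

lemma zeroDiff_d (X : ℤ → C) (i j : ℤ) : (zeroDiffComplex X).d i j = 0 := rfl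

/-- The projection from a complex with zero differentials to one of its terms. -/
noncomputable def projSingle (X : ℤ → C) (j : ℤ) :
    zeroDiffComplex X ⟶ (HomologicalComplex.single C (ComplexShape.up ℤ) j).obj
      ((zeroDiffComplex X).X j) :=
  HomologicalComplex.mkHomToSingle (𝟙 ((zeroDiffComplex X).X j)) (fun i _ => by rw [zeroDiff_d X i j, zero_comp])

/-- The projection as a morphism in the derived category. -/
noncomputable def projQ (X : ℤ → C) (j : ℤ) :
    Q.obj (zeroDiffComplex X) ⟶ (singleFunctor C j).obj (X j) :=
  Q.map (projSingle X j)

lemma isIso_projSingle (X : ℤ → C) (j : ℤ) :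
    IsIso ((homologyFunctor C j).map (Q.map (projSingle X j))) := by
  refine (NatIso.isIso_map_iff (homologyFunctorFactors C j) (projSingle X j)).2 ?_
  change IsIso (ShortComplex.homologyMap
    ((HomologicalComplex.shortComplexFunctor C (ComplexShape.up ℤ) j).map (projSingle X j)))
  have : IsIso ((projSingle X j).f j) := by
    rw [projSingle, HomologicalComplex.mkHomToSingle_f]
    infer_instance
  have h2 := (ShortComplex.LeftHomologyMapData.ofZeros
    ((HomologicalComplex.shortComplexFunctor C (ComplexShape.up ℤ) j).map (projSingle X j))
    rfl rfl rfl rfl).quasiIso_iff.2 this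
  exact h2.isIso

lemma isIso_projQ (X : ℤ → C) (j : ℤ) : IsIso ((homologyFunctor C j).map (projQ X j)) :=
  isIso_projSingle X j

lemma isZero_zeroDiff (X : ℤ → C) (j : ℤ) (h : IsZero (X j)) :
    IsZero ((homologyFunctor C j).obj (Q.obj (zeroDiffComplex X))) :=
  (ShortComplex.isZero_homology_of_isZero_X₂
    ((zeroDiffComplex X).sc j) h).of_iso ((homologyFunctorFactors C j).app (zeroDiffComplex X))

end DeligneAux

end Helpers

/-- **Deligne's decomposition criterion.**
Let `𝒜` be an abelian category, `K` an object of `D^b(𝒜)` (represented by a cochain complex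
with bounded cohomology), and `η : K → K[2]` a morphism in the derived category.  If for
every `i ≥ 1` the map induced by the `i`-fold composite `η^i : K → K[2i]` on cohomology
`H^{−i}(K) → H^{−i}(K[2i]) = H^{i}(K)` is an isomorphism, then `K ≅ ⊕_n H^n(K)[−n]` in
`D^b(𝒜)` (the direct sum being represented by the complex with objects `H^n(K)` and zero
differentials). -/
theorem stmt_10 {C : Type u} [Category.{v} C] [Abelian C] [HasDerivedCategory.{w} C]
    (K : CochainComplex C ℤ)
    (hbdd : ∃ a b : ℤ, ∀ n : ℤ, (n < a ∨ b < n) → IsZero (K.homology n))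
    (η : DerivedCategory.Q.obj K ⟶ (DerivedCategory.Q.obj K)⟦(2 : ℤ)⟧)
    (hiso : ∀ i : ℕ, 1 ≤ i →
      IsIso ((DerivedCategory.homologyFunctor C (-(i : ℤ))).map
        (etaPow (DerivedCategory.Q.obj K) η i))) :
    Nonempty (DerivedCategory.Q.obj K ≅
      DerivedCategory.Q.obj (zeroDiffComplex fun n => K.homology n)) := by
  obtain ⟨a, b, hab⟩ := hbdd
  have hab' : ∀ n : ℤ, (n < a ∨ b < n) →
      IsZero ((DerivedCategory.homologyFunctor C n).obj (DerivedCategory.Q.obj K)) := fun n hn =>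
    (hab n hn).of_iso ((DerivedCategory.homologyFunctorFactors C n).app K)
  have hsec := DeligneAux.hasSection_all (a.natAbs + b.natAbs) (DerivedCategory.Q.obj K)
    ((DerivedCategory.isGE_iff _ _).2 fun n hn => hab' n (by lia))
    ((DerivedCategory.isLE_iff _ _).2 fun n hn => hab' n (by lia))
    (fun i hi => ⟨_, hiso i hi⟩)
  choose s hs using fun j => DeligneAux.exists_single K j (hsec j)
  let φ : DerivedCategory.Q.obj (zeroDiffComplex fun n => K.homology n) ⟶
      DerivedCategory.Q.obj K :=
    ∑ j ∈ Finset.Icc a b,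
      DeligneAux.projQ (fun n => K.homology n) j ≫ s j
  have hφ : IsIso φ := by
    rw [DerivedCategory.isIso_iff]
    intro m
    by_cases hm : m < a ∨ b < m
    · exact DeligneAux.isIso_of_zeros _ (DeligneAux.isZero_zeroDiff _ m (hab m hm)) (hab' m hm)
    · have h1 := DeligneAux.isIso_projQ (fun n => K.homology n) m
      have h2 := hs m
      have h3 : (DerivedCategory.homologyFunctor C m).map φ =
          (DerivedCategory.homologyFunctor C m).map
            (DeligneAux.projQ (fun n => K.homology n) m) ≫
          (DerivedCategory.homologyFunctor C m).map (s m) := by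
        rw [Functor.map_sum, Finset.sum_eq_single m, Functor.map_comp]
        · intro j _ hj
          rw [Functor.map_comp]
          have hz : IsZero ((DerivedCategory.homologyFunctor C m).obj
              ((DerivedCategory.singleFunctor C j).obj (K.homology j))) := by
            rcases lt_or_gt_of_ne hj with h | h
            · exact DerivedCategory.isZero_of_isLE _ j m h
            · exact DerivedCategory.isZero_of_isGE _ j m h
          rw [hz.eq_of_src ((DerivedCategory.homologyFunctor C m).map (s j)) 0, comp_zero]
        · intro hm'
          exact absurd (Finset.mem_Icc.2 ⟨by lia, by lia⟩) hm'
      rw [h3]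
      exact IsIso.comp_isIso' h1 h2
  exact ⟨(asIso φ).symm⟩
end
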